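/- Let H = (V, E) be a finite hypergraph with |V| = n and let v_1, v_2, …, v_n be an ordering of V such that for every i, the node v_i has minimum degree in the induced hypergraph H|_{{v_i, v_{i+1}, …, v_n}}. Then the quark numbers are nondecreasing along this order: K(v_1) ≤ K(v_2) ≤ … ≤ K(v_n). -/

import Mathlib

variable {V : Type*}

/-- Degree of node `v` in the hypergraph with hyperedge set `E` induced on `S`:
the number of hyperedges contained in `S` that contain `v`. -/
def hdeg [DecidableEq V] (E : Finset (Finset V)) (S : Finset V) (v : V) : ℕ :=
  (E.filter fun e => v ∈ e ∧ e ⊆ S).card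

/-- Nodes `u` and `v` are connected in the hypergraph induced on `S`:
there is a nonempty sequence of hyperedges of `H|_S` starting at an edge containing `u`,
ending at an edge containing `v`, with consecutive edges intersecting. -/
def HConn [DecidableEq V] (E : Finset (Finset V)) (S : Finset V) (u v : V) : Prop :=
  ∃ (l : List (Finset V)) (hl : l ≠ []),
    (∀ e ∈ l, e ∈ E ∧ e ⊆ S) ∧ u ∈ l.head hl ∧ v ∈ l.getLast hl ∧
    l.Chain' fun e f => (e ∩ f).Nonempty

/-- The hypergraph induced on `S` is connected. -/
def ConnectedOn [DecidableEq V] (E : Finset (Finset V)) (S : Finset V) : Prop :=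
  ∀ u ∈ S, ∀ v ∈ S, HConn E S u v

/-- `S` is a `k`-quark: the induced hypergraph is connected, has minimum degree at least `k`,
and `S` is maximal with these two properties. -/
def IsQuark [DecidableEq V] (E : Finset (Finset V)) (k : ℕ) (S : Finset V) : Prop :=
  ConnectedOn E S ∧ (∀ v ∈ S, k ≤ hdeg E S v) ∧
    ∀ T : Finset V, S ⊆ T → ConnectedOn E T → (∀ v ∈ T, k ≤ hdeg E T v) → T = S

/-- The quark number of `u`: the largest `k` such that `u` belongs to a nonempty `k`-quark. -/
noncomputable def quarkNum [DecidableEq V] (E : Finset (Finset V)) (u : V) : ℕ :=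
  sSup {k : ℕ | ∃ S : Finset V, IsQuark E k S ∧ u ∈ S}

section Connectivity

variable [DecidableEq V] {E : Finset (Finset V)} {S T : Finset V} {u v w : V}

theorem HConn.symm (h : HConn E S u v) : HConn E S v u := by
  obtain ⟨l, hl, hE, hu, hv, hc⟩ := h
  refine ⟨l.reverse, by simpa using hl, by simpa using hE, by simpa using hv,
    by simpa using hu, ?_⟩
  rw [List.Chain', List.isChain_reverse]
  exact hc.imp fun e f h => by rwa [Finset.inter_comm]

theorem HConn.trans (huv : HConn E S u v) (hvw : HConn E S v w) : HConn E S u w := by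
  obtain ⟨l, hl, hE, hu, hv, hc⟩ := huv
  obtain ⟨m, hm, hE', hv', hw, hc'⟩ := hvw
  refine ⟨l ++ m, by simp [hl], fun e he => (List.mem_append.1 he).elim (hE e) (hE' e),
    by rwa [List.head_append_of_ne_nil hl], by rwa [List.getLast_append_of_ne_nil _ hm], ?_⟩
  refine List.IsChain.append hc hc' fun e he f hf => ⟨v, ?_⟩
  rw [List.getLast?_eq_some_getLast hl, Option.mem_some_iff] at he
  rw [List.head?_eq_some_head hm, Option.mem_some_iff] at hf
  subst he hf
  exact Finset.mem_inter.2 ⟨hv, hv'⟩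

theorem HConn.of_mem_edge {e : Finset V} (he : e ∈ E) (heS : e ⊆ S) (hu : u ∈ e) (hv : v ∈ e) :
    HConn E S u v :=
  ⟨[e], by simp, by simp [he, heS], by simpa, by simpa, List.isChain_singleton e⟩

open Classical in
/-- The connected component of `u` in the hypergraph induced on `S`. -/
noncomputable def hcomponent (E : Finset (Finset V)) (S : Finset V) (u : V) : Finset V :=
  S.filter (HConn E S u)

theorem mem_hcomponent : v ∈ hcomponent E S u ↔ v ∈ S ∧ HConn E S u v := by
  simp [hcomponent]

theorem HConn.hcomponent (h : HConn E S u v) : HConn E (hcomponent E S u) u v := by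
  obtain ⟨l, hl, hE, hu, hv, hc⟩ := h
  refine ⟨l, hl, fun e he => ⟨(hE e he).1, fun x hx => ?_⟩, hu, hv, hc⟩
  refine mem_hcomponent.2 ⟨(hE e he).2 hx, ?_⟩
  obtain ⟨l₁, l₂, rfl⟩ := List.append_of_mem he
  refine ⟨l₁ ++ [e], by simp, fun f hf => hE f ?_, ?_, by simpa using hx, ?_⟩
  · simp only [List.mem_append, List.mem_cons] at hf ⊢
    grind
  · cases l₁ <;> simpa using hu
  · exact List.IsChain.left_of_append (l₂ := l₂) (by simpa [List.Chain'] using hc)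

theorem connectedOn_hcomponent : ConnectedOn E (hcomponent E S u) := fun _ ha _ hb =>
  (mem_hcomponent.1 ha).2.hcomponent.symm.trans (mem_hcomponent.1 hb).2.hcomponent

theorem hdeg_mono (h : S ⊆ T) : hdeg E S v ≤ hdeg E T v :=
  Finset.card_le_card <| Finset.monotone_filter_right E fun _ _ he => ⟨he.1, he.2.trans h⟩

theorem hdeg_le_hdeg_hcomponent (hv : v ∈ hcomponent E S u) :
    hdeg E S v ≤ hdeg E (hcomponent E S u) v := by
  refine Finset.card_le_card fun e he => ?_
  simp only [Finset.mem_filter] at he ⊢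
  obtain ⟨heE, hve, heS⟩ := he
  exact ⟨heE, hve, fun x hx => mem_hcomponent.2
    ⟨heS hx, (mem_hcomponent.1 hv).2.trans (.of_mem_edge heE heS hve hx)⟩⟩

theorem mem_hcomponent_self (hu : u ∈ S) (hd : 0 < hdeg E S u) : u ∈ hcomponent E S u := by
  obtain ⟨e, he⟩ := Finset.card_pos.1 hd
  simp only [Finset.mem_filter] at he
  exact mem_hcomponent.2 ⟨hu, .of_mem_edge he.1 he.2.2 he.2.1 he.2.1⟩

theorem exists_isQuark_superset [Finite V] {k : ℕ} (hc : ConnectedOn E S)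
    (hd : ∀ v ∈ S, k ≤ hdeg E S v) : ∃ T, S ⊆ T ∧ IsQuark E k T := by
  obtain ⟨T, hST, hT⟩ := Set.Finite.exists_le_maximal
    (Set.toFinite {T : Finset V | ConnectedOn E T ∧ ∀ v ∈ T, k ≤ hdeg E T v}) ⟨hc, hd⟩
  exact ⟨T, hST, hT.prop.1, hT.prop.2, fun U hTU hU hU' =>
    (hT.eq_of_le ⟨hU, hU'⟩ hTU).symm⟩

theorem bddAbove_quark : BddAbove {k : ℕ | ∃ S : Finset V, IsQuark E k S ∧ u ∈ S} :=
  ⟨E.card, fun _ ⟨_, hS, hu⟩ => (hS.2.1 u hu).trans (Finset.card_filter_le _ _)⟩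

theorem exists_isQuark_quarkNum (h : 0 < quarkNum E u) :
    ∃ S, IsQuark E (quarkNum E u) S ∧ u ∈ S := by
  refine Nat.sSup_mem (Set.nonempty_iff_ne_empty.2 fun h0 => ?_) bddAbove_quark
  simp [quarkNum, h0] at h

theorem le_quarkNum [Finite V] {k : ℕ} (hu : u ∈ S) (hd : ∀ v ∈ S, k ≤ hdeg E S v) :
    k ≤ quarkNum E u := by
  rcases Nat.eq_zero_or_pos k with rfl | hk
  · exact Nat.zero_le _
  obtain ⟨T, hCT, hT⟩ := exists_isQuark_superset (k := k) (connectedOn_hcomponent (u := u))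
    fun v hv => (hd v (mem_hcomponent.1 hv).1).trans (hdeg_le_hdeg_hcomponent hv)
  exact le_csSup bddAbove_quark ⟨T, hT, hCT (mem_hcomponent_self hu (hk.trans_le (hd u hu)))⟩

end Connectivity

/-- along a peeling order (each peeled node has minimum degree in the
remaining induced hypergraph), the quark numbers are nondecreasing. -/
theorem stmt_10 [Fintype V] [DecidableEq V] (E : Finset (Finset V)) (n : ℕ)
    (hn : Fintype.card V = n) (v : Fin n → V) (hv : Function.Bijective v)
    (S : Fin n → Finset V)
    (hS : ∀ i, S i = Finset.image v (Finset.univ.filter fun j => i ≤ j))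
    (hmin : ∀ i, ∀ w ∈ S i, hdeg E (S i) (v i) ≤ hdeg E (S i) w) :
    ∀ i j : Fin n, i ≤ j → quarkNum E (v i) ≤ quarkNum E (v j) := by
  intro i j hij
  rcases Nat.eq_zero_or_pos (quarkNum E (v i)) with h0 | hpos
  · simp [h0]
  obtain ⟨Q, hQ, hiQ⟩ := exists_isQuark_quarkNum hpos
  obtain ⟨m, hmQ, hm⟩ := Set.Finite.exists_minimal (Set.toFinite {a | v a ∈ Q}) ⟨i, hiQ⟩
  have hle : ∀ a, v a ∈ Q → m ≤ a := fun a ha => (le_total m a).elim id (hm ha)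
  have hQS : Q ⊆ S m := fun x hx => by
    obtain ⟨a, rfl⟩ := hv.surjective x
    simpa [hS, hv.injective.eq_iff] using hle a hx
  have hj : v j ∈ S m := by
    simpa [hS, hv.injective.eq_iff] using (hle i hiQ).trans hij
  exact le_quarkNum hj fun w hw =>
    ((hQ.2.1 _ hmQ).trans (hdeg_mono hQS)).trans (hmin m w hw)
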